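/- Let w be a permutation of {1,…,n} and let g ∈ B₋wB₋. Then the matrix ẇ⁻¹·g admits a UDL factorization, and its unipotent upper factor satisfies ẇ·[ẇ⁻¹g]_L^+·ẇ⁻¹ ∈ N₋. -/

import Mathlib

open Matrix Finset

namespace Paper

open scoped Classical

noncomputable section

variable {K : Type*} [Field K] {n m : ℕ}

/-- `N`: upper unitriangular matrices. -/
def IsN (g : Matrix (Fin n) (Fin n) K) : Prop :=
  (∀ i, g i i = 1) ∧ ∀ i j : Fin n, j < i → g i j = 0

/-- `N₋`: lower unitriangular matrices. -/
def IsNm (g : Matrix (Fin n) (Fin n) K) : Prop :=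
  (∀ i, g i i = 1) ∧ ∀ i j : Fin n, i < j → g i j = 0

/-- `B`: upper triangular matrices of determinant 1. -/
def IsB (g : Matrix (Fin n) (Fin n) K) : Prop :=
  g.det = 1 ∧ ∀ i j : Fin n, j < i → g i j = 0

/-- `B₋`: lower triangular matrices of determinant 1. -/
def IsBm (g : Matrix (Fin n) (Fin n) K) : Prop :=
  g.det = 1 ∧ ∀ i j : Fin n, i < j → g i j = 0

/-- `H`: diagonal matrices of determinant 1. -/
def IsH (g : Matrix (Fin n) (Fin n) K) : Prop :=
  g.det = 1 ∧ ∀ i j : Fin n, i ≠ j → g i j = 0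

/-- UDL factorization: `g = yp * y0 * ym` with `yp ∈ N`, `y0 ∈ H`, `ym ∈ N₋`. -/
def UDL (g yp y0 ym : Matrix (Fin n) (Fin n) K) : Prop :=
  IsN yp ∧ IsH y0 ∧ IsNm ym ∧ g = yp * y0 * ym

/-- LDU factorization: `g = zm * z0 * zp` with `zm ∈ N₋`, `z0 ∈ H`, `zp ∈ N`. -/
def LDU (g zm z0 zp : Matrix (Fin n) (Fin n) K) : Prop :=
  IsNm zm ∧ IsH z0 ∧ IsN zp ∧ g = zm * z0 * zp

/-- The signed permutation matrix `v̇`. -/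
def pdot (v : Equiv.Perm (Fin n)) : Matrix (Fin n) (Fin n) K :=
  Matrix.of fun a b : Fin n =>
    if a = v b then
      (-1 : K) ^ (univ.filter fun k : Fin n => b < k ∧ v k < v b).card
    else 0

/-- Membership in the double coset `B₋ w B₋`. -/
def InBmWBm (w : Equiv.Perm (Fin n)) (g : Matrix (Fin n) (Fin n) K) : Prop :=
  ∃ b₁ b₂ : Matrix (Fin n) (Fin n) K, IsBm b₁ ∧ IsBm b₂ ∧ g = b₁ * pdot w * b₂

/-- `Δ^I_J(g)`: the minor with row set `I` and column set `J` (junk value 0 if sizes differ). -/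
def minor (g : Matrix (Fin n) (Fin n) K) (I J : Finset (Fin n)) : K :=
  if h : I.card = J.card then
    Matrix.det (Matrix.of fun a b : Fin I.card =>
      g (I.orderEmbOfFin rfl a) (J.orderEmbOfFin h.symm b))
  else 0

/-- All right-aligned flag minors of `g` are nonnegative. -/
def RightFlagNonneg (g : Matrix (Fin n) (Fin n) ℝ) : Prop :=
  ∀ I : Finset (Fin n),
    0 ≤ minor g I (univ.filter fun j : Fin n => n - I.card ≤ (j : ℕ))

/-- All top-aligned flag minors of `g` are nonnegative. -/
def TopFlagNonneg (g : Matrix (Fin n) (Fin n) ℝ) : Prop :=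
  ∀ J : Finset (Fin n),
    0 ≤ minor g (univ.filter fun i : Fin n => (i : ℕ) < J.card) J

/-- `x_i(t)` (with 1-based `i`): `Id + t·E_{i,i+1}`. -/
def xmat (i : ℕ) (t : K) : Matrix (Fin n) (Fin n) K :=
  Matrix.of fun a b : Fin n =>
    if a = b then 1 else if (a : ℕ) + 1 = i ∧ (b : ℕ) = i then t else 0

/-- `y_i(t)` (with 1-based `i`): `Id + t·E_{i+1,i}`. -/
def ymat (i : ℕ) (t : K) : Matrix (Fin n) (Fin n) K :=
  Matrix.of fun a b : Fin n =>
    if a = b then 1 else if (a : ℕ) = i ∧ (b : ℕ) + 1 = i then t else 0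

/-- `ṡ_i` (with 1-based `i`). -/
def sdot (i : ℕ) : Matrix (Fin n) (Fin n) K :=
  Matrix.of fun a b : Fin n =>
    if (a : ℕ) + 1 = i ∧ (b : ℕ) = i then 1
    else if (a : ℕ) = i ∧ (b : ℕ) + 1 = i then -1
    else if a = b ∧ (a : ℕ) + 1 ≠ i ∧ (a : ℕ) ≠ i then 1
    else 0

/-- The adjacent transposition `s_i` (with 1-based `i`); identity if out of range. -/
def sperm (n : ℕ) (i : ℕ) : Equiv.Perm (Fin n) :=
  if h : i < n then
    Equiv.swap ⟨i - 1, Nat.lt_of_le_of_lt (Nat.sub_le i 1) h⟩ ⟨i, h⟩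
  else 1

/-- `ℓ(w)`: the number of inversions of `w`. -/
def len (w : Equiv.Perm (Fin n)) : ℕ :=
  (univ.filter fun p : Fin n × Fin n => p.1 < p.2 ∧ w p.2 < w p.1).card

/-- `vseq ii v k = v_{(m-k)}`: the rightmost (positive distinguished) subexpression recursion. -/
def vseq (ii : Fin m → ℕ) (v : Equiv.Perm (Fin n)) : ℕ → Equiv.Perm (Fin n)
  | 0 => v
  | k + 1 =>
    if h : m - k - 1 < m then
      if len (vseq ii v k * sperm n (ii ⟨m - k - 1, h⟩)) < len (vseq ii v k) then
        vseq ii v k * sperm n (ii ⟨m - k - 1, h⟩)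
      else vseq ii v k
    else vseq ii v k

/-- `r ∈ J°` (0-based `r`, corresponding to the 1-based index `r+1`). -/
def inJ (ii : Fin m → ℕ) (v : Equiv.Perm (Fin n)) (r : Fin m) : Prop :=
  vseq ii v (m - (r : ℕ)) = vseq ii v (m - (r : ℕ) - 1)

/-- The list `[s_{i_1}, …, s_{i_m}]` of adjacent transpositions. -/
def sPermList (n : ℕ) (ii : Fin m → ℕ) : List (Equiv.Perm (Fin n)) :=
  List.ofFn fun r => sperm n (ii r)

/-- The list `[s^v_{i_1}, …, s^v_{i_m}]`. -/
def svPermList (ii : Fin m → ℕ) (v : Equiv.Perm (Fin n)) : List (Equiv.Perm (Fin n)) :=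
  List.ofFn fun r => if inJ ii v r then 1 else sperm n (ii r)

/-- The factors `g_1, …, g_m` of the Marsh–Rietsch element. -/
def mrgList (ii : Fin m → ℕ) (v : Equiv.Perm (Fin n)) (t : Fin m → K) :
    List (Matrix (Fin n) (Fin n) K) :=
  List.ofFn fun r => if inJ ii v r then xmat (ii r) (t r) else sdot (ii r)

/-- The Marsh–Rietsch element `g = g_1 ⋯ g_m`. -/
def mrg (ii : Fin m → ℕ) (v : Equiv.Perm (Fin n)) (t : Fin m → K) :
    Matrix (Fin n) (Fin n) K :=
  (mrgList ii v t).prod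

/-- The list `[ṡ_{i_1}, …, ṡ_{i_m}]`. -/
def sdotList (n : ℕ) (ii : Fin m → ℕ) : List (Matrix (Fin n) (Fin n) K) :=
  List.ofFn fun r => sdot (ii r)

/-- `ẇ = ṡ_{i_1} ⋯ ṡ_{i_m}`. -/
def wMR (n : ℕ) (ii : Fin m → ℕ) : Matrix (Fin n) (Fin n) K :=
  (sdotList n ii).prod

lemma diag_mul_tri {n : ℕ} {α : Type*} [LinearOrder α] {f : Fin n → α}
    (hf : Function.Injective f) {A B : Matrix (Fin n) (Fin n) ℂ}
    (hA : BlockTriangular A f) (hB : BlockTriangular B f) (i : Fin n) :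
    (A * B) i i = A i i * B i i := by
  rw [Matrix.mul_apply]
  apply Finset.sum_eq_single i
  · intro k _ hk
    rcases lt_trichotomy (f k) (f i) with h | h | h
    · rw [hA h, zero_mul]
    · exact absurd (hf h) hk
    · rw [hB h, mul_zero]
  · simp

lemma diag_inv_tri {n : ℕ} {α : Type*} [LinearOrder α] {f : Fin n → α}
    (hf : Function.Injective f) {A : Matrix (Fin n) (Fin n) ℂ}
    (hA : BlockTriangular A f) (hdet : A.det = 1) (h1 : ∀ i, A i i = 1) :
    BlockTriangular A⁻¹ f ∧ ∀ i, A⁻¹ i i = 1 := by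
  have hu : IsUnit A.det := by rw [hdet]; exact isUnit_one
  let _ := Matrix.invertibleOfIsUnitDet A hu
  have h2 : BlockTriangular A⁻¹ f := blockTriangular_inv_of_blockTriangular hA
  refine ⟨h2, fun i => ?_⟩
  have h3 := diag_mul_tri hf h2 hA i
  rw [Matrix.nonsing_inv_mul A hu, Matrix.one_apply_eq, h1, mul_one] at h3
  exact h3.symm

lemma isN_iff {n : ℕ} (A : Matrix (Fin n) (Fin n) ℂ) :
    IsN A ↔ (∀ i, A i i = 1) ∧ BlockTriangular A id :=
  ⟨fun h => ⟨h.1, fun i j hij => h.2 i j hij⟩, fun h => ⟨h.1, fun _ _ hij => h.2 hij⟩⟩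

lemma isNm_iff {n : ℕ} (A : Matrix (Fin n) (Fin n) ℂ) :
    IsNm A ↔ (∀ i, A i i = 1) ∧ BlockTriangular A OrderDual.toDual :=
  ⟨fun h => ⟨h.1, fun i j hij => h.2 i j hij⟩, fun h => ⟨h.1, fun i j hij => h.2 (i := i) (j := j) hij⟩⟩

lemma isN_det {n : ℕ} {A : Matrix (Fin n) (Fin n) ℂ} (h : IsN A) : A.det = 1 := by
  rw [Matrix.det_of_isUpperTriangular ((isN_iff A).1 h).2]
  simp [h.1]

lemma isNm_det {n : ℕ} {A : Matrix (Fin n) (Fin n) ℂ} (h : IsNm A) : A.det = 1 := by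
  rw [Matrix.det_of_isLowerTriangular A ((isNm_iff A).1 h).2]
  simp [h.1]

/-- The sign in column `b`. -/
def psgn {n : ℕ} (v : Equiv.Perm (Fin n)) (b : Fin n) : ℂ :=
  (-1 : ℂ) ^ (univ.filter fun k : Fin n => b < k ∧ v k < v b).card

lemma psgn_sq {n : ℕ} (v : Equiv.Perm (Fin n)) (b : Fin n) : psgn v b * psgn v b = 1 := by
  unfold psgn
  rw [← mul_pow]; simp

lemma pdot_apply {n : ℕ} (v : Equiv.Perm (Fin n)) (a b : Fin n) :
    (pdot v : Matrix (Fin n) (Fin n) ℂ) a b = if a = v b then psgn v b else 0 := rfl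

lemma conj_apply {n : ℕ} (v : Equiv.Perm (Fin n)) (X : Matrix (Fin n) (Fin n) ℂ) (i j : Fin n) :
    ((pdot v : Matrix (Fin n) (Fin n) ℂ)ᵀ * X * (pdot v : Matrix (Fin n) (Fin n) ℂ) : Matrix (Fin n) (Fin n) ℂ) i j
      = psgn v i * X (v i) (v j) * psgn v j := by
  simp [Matrix.mul_apply, pdot_apply]

lemma pdot_inv {n : ℕ} (v : Equiv.Perm (Fin n)) :
    (pdot v : Matrix (Fin n) (Fin n) ℂ)⁻¹ = (pdot v)ᵀ := by
  apply Matrix.inv_eq_left_inv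
  have : (pdot v : Matrix (Fin n) (Fin n) ℂ)ᵀ * pdot v = (pdot v)ᵀ * 1 * pdot v := by simp
  rw [this]
  ext i j
  rw [conj_apply]
  by_cases h : i = j
  · subst h; simp [psgn_sq]
  · simp [h]

/-- Row elimination. -/
lemma exists_row {n : ℕ} (w : Equiv.Perm (Fin n)) (b : Matrix (Fin n) (Fin n) ℂ)
    (hb : IsBm b) (p : Fin n) :
    ∃ x : Fin n → ℂ, x p = 1 ∧ (∀ q, p < q → x q = 0) ∧
      (∀ q, w.symm q < w.symm p → x q = 0) ∧
      ∀ q, w.symm p < w.symm q → ∑ r, x r * b r q = 0 := by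
  let S : Fin n → Prop := fun q => q < p ∧ w.symm p < w.symm q
  have hdiag : ∀ i, b i i ≠ 0 := by
    have h := hb.1
    rw [Matrix.det_of_isLowerTriangular b (fun i j hij => hb.2 i j hij)] at h
    intro i hi
    exact zero_ne_one ((Finset.prod_eq_zero (f := fun i => b i i) (Finset.mem_univ i) hi).symm.trans h)
  let M : Matrix {q // S q} {q // S q} ℂ := b.submatrix Subtype.val Subtype.val
  have hM : IsUnit M.det := by
    rw [Matrix.det_of_isLowerTriangular M (fun i j hij => hb.2 _ _ hij)]
    rw [isUnit_iff_ne_zero]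
    exact Finset.prod_ne_zero_iff.2 fun i _ => hdiag _
  let y : {q // S q} → ℂ := (fun q : {q // S q} => - b p q) ᵥ* M⁻¹
  have hy : y ᵥ* M = fun q : {q // S q} => - b p q := by
    simp only [y]
    rw [Matrix.vecMul_vecMul, Matrix.nonsing_inv_mul M hM, Matrix.vecMul_one]
  refine ⟨fun q => if q = p then 1 else if h : S q then y ⟨q, h⟩ else 0, by simp, ?_, ?_, ?_⟩
  · intro q hq
    have h1 : ¬ S q := fun h => absurd h.1 hq.asymm
    simp [hq.ne', h1]
  · intro q hq
    have h1 : ¬ S q := fun h => absurd h.2 hq.asymm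
    have h2 : q ≠ p := by rintro rfl; exact lt_irrefl _ hq
    simp [h1, h2]
  · intro q hq
    have hpq : q ≠ p := by rintro rfl; exact lt_irrefl _ hq
    have hSp : ¬ S p := fun h => lt_irrefl _ h.1
    have key : ∑ r, (if r = p then 1 else if h : S r then y ⟨r, h⟩ else 0) * b r q
        = b p q + ∑ r : {r // S r}, y r * b r q := by
      have e1 : ∀ r, (if r = p then 1 else if h : S r then y ⟨r, h⟩ else 0) * b r q
          = (if r = p then b p q else 0) + (if h : S r then y ⟨r, h⟩ * b r q else 0) := by
        intro r
        by_cases hr : r = p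
        · subst hr; simp [hSp]
        · by_cases hs : S r <;> simp [hr, hs]
      rw [Finset.sum_congr rfl fun r _ => e1 r, Finset.sum_add_distrib]
      congr 1
      · simp
      · rw [← Finset.sum_filter_add_sum_filter_not univ S]
        rw [Finset.sum_eq_zero (s := univ.filter fun r => ¬ S r) (by
          intro r hr
          rw [dif_neg (Finset.mem_filter.1 hr).2]), add_zero]
        rw [Finset.sum_subtype (p := S) _ (by simp)]
        exact Finset.sum_congr rfl fun r _ => by rw [dif_pos r.2]
    rw [key]
    by_cases hqp : q < p
    · have := congrFun hy ⟨q, hqp, hq⟩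
      simp only [Matrix.vecMul, dotProduct, M, Matrix.submatrix_apply] at this
      rw [this]; simp
    · have hlt : p < q := lt_of_le_of_ne (not_lt.1 hqp) hpq.symm
      rw [hb.2 p q hlt, zero_add]
      apply Finset.sum_eq_zero
      intro r _
      rw [hb.2 r q (r.2.1.trans hlt), mul_zero]

lemma exists_factor {n : ℕ} (w : Equiv.Perm (Fin n))
    (g : Matrix (Fin n) (Fin n) ℂ) (hdet : g.det = 1) (hg : InBmWBm w g) :
    ∃ a b c, UDL ((pdot w : Matrix (Fin n) (Fin n) ℂ)⁻¹ * g) a b c ∧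
      IsNm (pdot w * a * (pdot w : Matrix (Fin n) (Fin n) ℂ)⁻¹) := by
  obtain ⟨b₁, b₂, h₁, h₂, rfl⟩ := hg
  have hw : (pdot w : Matrix (Fin n) (Fin n) ℂ).det = 1 := by
    simpa [Matrix.det_mul, h₁.1, h₂.1] using hdet
  have hwu : IsUnit (pdot w : Matrix (Fin n) (Fin n) ℂ).det := by rw [hw]; exact isUnit_one
  have hwr : (pdot w : Matrix (Fin n) (Fin n) ℂ) * (pdot w)⁻¹ = 1 := Matrix.mul_nonsing_inv _ hwu
  choose x hx1 hx2 hx3 hx4 using exists_row w b₁ h₁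
  let P : Matrix (Fin n) (Fin n) ℂ := Matrix.of x
  have hP : IsNm P := ⟨hx1, hx2⟩
  have hPd := isNm_det hP
  have hPu : IsUnit P.det := by rw [hPd]; exact isUnit_one
  have hP' := (isNm_iff P).1 hP
  have hPi : IsNm P⁻¹ := by
    rw [isNm_iff]
    have := diag_inv_tri OrderDual.toDual.injective hP'.2 hPd hP'.1
    exact ⟨this.2, this.1⟩
  have hPw : BlockTriangular P⁻¹ w.symm :=
    (diag_inv_tri w.symm.injective (A := P) (fun i j hij => hx3 i j hij) hPd hx1).1
  let C : Matrix (Fin n) (Fin n) ℂ := (pdot w)⁻¹ * (P * b₁) * pdot w * b₂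
  have hC0 : BlockTriangular ((pdot w : Matrix (Fin n) (Fin n) ℂ)⁻¹ * (P * b₁) * pdot w)
      OrderDual.toDual := by
    intro i j hij
    have hij' : i < j := hij
    rw [pdot_inv, conj_apply]
    have : (P * b₁) (w i) (w j) = 0 := by
      rw [Matrix.mul_apply]
      exact hx4 (w i) (w j) (by simpa using hij')
    rw [this]; simp
  have hC : BlockTriangular C OrderDual.toDual := hC0.mul (fun i j hij => h₂.2 i j hij)
  have hCd : C.det = 1 := by
    simp only [C, Matrix.det_mul, h₁.1, h₂.1, hPd, hw, Matrix.det_nonsing_inv]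
    simp
  have hCp : ∏ i, C i i = 1 := by rw [← Matrix.det_of_isLowerTriangular C hC]; exact hCd
  have hCi : ∀ i, C i i ≠ 0 := fun i hi => by
    exact zero_ne_one ((Finset.prod_eq_zero (f := fun i => C i i) (Finset.mem_univ i) hi).symm.trans hCp)
  have hDC : Matrix.diagonal (fun i => C i i) *
      (Matrix.diagonal (fun i => (C i i)⁻¹) * C) = C := by
    rw [← Matrix.mul_assoc, Matrix.diagonal_mul_diagonal]
    simp [hCi]
  refine ⟨(pdot w)⁻¹ * P⁻¹ * pdot w, Matrix.diagonal (fun i => C i i),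
    Matrix.diagonal (fun i => (C i i)⁻¹) * C, ⟨?_, ?_, ?_, ?_⟩, ?_⟩
  · constructor
    · intro i
      rw [pdot_inv, conj_apply, hPi.1, mul_one, psgn_sq]
    · intro i j hij
      have : P⁻¹ (w i) (w j) = 0 := hPw (by simpa using hij)
      rw [pdot_inv, conj_apply, this]; simp
  · refine ⟨by rw [Matrix.det_diagonal]; exact hCp, fun i j hij => Matrix.diagonal_apply_ne _ hij⟩
  · refine ⟨fun i => ?_, fun i j hij => ?_⟩
    · simp [Matrix.diagonal_mul, hCi]
    · rw [Matrix.diagonal_mul, hC (show OrderDual.toDual j < OrderDual.toDual i from hij), mul_zero]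
  · rw [Matrix.mul_assoc _ (Matrix.diagonal _), hDC]
    calc (pdot w)⁻¹ * (b₁ * pdot w * b₂)
        = (pdot w)⁻¹ * ((P⁻¹ * P) * b₁) * pdot w * b₂ := by
          rw [Matrix.nonsing_inv_mul P hPu]; simp only [Matrix.one_mul, Matrix.mul_assoc]
      _ = (pdot w)⁻¹ * P⁻¹ * (pdot w * (pdot w)⁻¹) * (P * b₁) * pdot w * b₂ := by
          rw [hwr]; simp only [Matrix.mul_one, Matrix.mul_assoc]
      _ = _ := by simp only [C, Matrix.mul_assoc]
  · have : pdot w * ((pdot w)⁻¹ * P⁻¹ * pdot w) * (pdot w : Matrix (Fin n) (Fin n) ℂ)⁻¹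
        = (pdot w * (pdot w)⁻¹) * P⁻¹ * (pdot w * (pdot w)⁻¹) := by
      simp only [Matrix.mul_assoc]
    rw [this, hwr]; simpa using hPi

lemma udl_unique {n : ℕ} {g a b c a' b' c' : Matrix (Fin n) (Fin n) ℂ}
    (h : UDL g a b c) (h' : UDL g a' b' c') : a = a' := by
  obtain ⟨ha, hb, hc, rfl⟩ := h
  obtain ⟨ha', hb', hc', he⟩ := h'
  have hbt : BlockTriangular b OrderDual.toDual := fun i j hij =>
    hb.2 i j (show i < j from hij).ne
  have hbt' : BlockTriangular b' OrderDual.toDual := fun i j hij =>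
    hb'.2 i j (show i < j from hij).ne
  have hC : BlockTriangular (b * c) OrderDual.toDual := hbt.mul ((isNm_iff c).1 hc).2
  have hC' : BlockTriangular (b' * c') OrderDual.toDual := hbt'.mul ((isNm_iff c').1 hc').2
  have hCu : IsUnit (b * c).det := by
    rw [Matrix.det_mul, hb.1, isNm_det hc]; simp
  have hau : IsUnit a'.det := by rw [isN_det ha']; exact isUnit_one
  let _ := Matrix.invertibleOfIsUnitDet (b * c) hCu
  have hCi : BlockTriangular (b * c)⁻¹ OrderDual.toDual :=
    blockTriangular_inv_of_blockTriangular hC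
  have hai := diag_inv_tri Function.injective_id ((isN_iff a').1 ha').2 (isN_det ha') ha'.1
  have hat := ((isN_iff a).1 ha).2
  have hE : a'⁻¹ * a = (b' * c') * (b * c)⁻¹ := by
    calc a'⁻¹ * a = a'⁻¹ * (a * b * c) * (b * c)⁻¹ := by
          rw [Matrix.mul_assoc a b c, ← Matrix.mul_assoc, Matrix.mul_assoc _ (b * c),
            Matrix.mul_nonsing_inv _ hCu, Matrix.mul_one]
      _ = _ := by
          rw [he, Matrix.mul_assoc a' b' c', ← Matrix.mul_assoc a'⁻¹,
            Matrix.nonsing_inv_mul _ hau, Matrix.one_mul]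
  have hone : a'⁻¹ * a = 1 := by
    ext i j
    rcases lt_trichotomy i j with h | h | h
    · rw [Matrix.one_apply_ne h.ne, hE]
      exact hC'.mul hCi (show OrderDual.toDual j < OrderDual.toDual i from h)
    · subst h
      rw [diag_mul_tri Function.injective_id hai.1 hat, hai.2, ha.1]; simp
    · rw [Matrix.one_apply_ne h.ne']
      exact hai.1.mul hat h
  calc a = a' * (a'⁻¹ * a) := by
        rw [← Matrix.mul_assoc, Matrix.mul_nonsing_inv _ hau, Matrix.one_mul]
    _ = a' := by rw [hone, Matrix.mul_one]

/-- for `g ∈ B₋wB₋`, `ẇ⁻¹g` has a UDL factorization with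
`ẇ·[ẇ⁻¹g]_L^+·ẇ⁻¹ ∈ N₋`. -/
theorem statement_6 {n : ℕ} (hn : 1 ≤ n) (w : Equiv.Perm (Fin n))
    (g : Matrix (Fin n) (Fin n) ℂ) (hdet : g.det = 1) (hg : InBmWBm w g) :
    (∃ a b c, UDL ((pdot w : Matrix (Fin n) (Fin n) ℂ)⁻¹ * g) a b c) ∧
    ∀ a b c, UDL ((pdot w : Matrix (Fin n) (Fin n) ℂ)⁻¹ * g) a b c →
      IsNm (pdot w * a * (pdot w : Matrix (Fin n) (Fin n) ℂ)⁻¹) := by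
  obtain ⟨a, b, c, h, ha⟩ := exists_factor w g hdet hg
  refine ⟨⟨a, b, c, h⟩, fun a' b' c' h' => ?_⟩
  rw [udl_unique h' h]
  exact ha

end
end Paper
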